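/- Let gamma : P' -> P' be a center-respecting function, let lambda : V' -> ZMod d' be an additive group homomorphism, and let phi lie in Sp(V', omega'), such that gamma(Delta_v) = tau^((lambda v).val) * Delta_(phi v) for all v in V'. Then gamma is a group automorphism of P' fixing the center of P' pointwise, i.e. gamma belongs to PCl'. -/

import Mathlib

noncomputable section

namespace PaperPCl

/-- `d' = 2d` if `d` is even, `d' = d` if `d` is odd. -/
def dp (d : ℕ) : ℕ := if Even d then 2 * d else d

lemma d_dvd_dp (d : ℕ) : d ∣ dp d := by
  unfold dp; split
  · exact dvd_mul_left d 2
  · rfl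

/-- The phase space `V = (ZMod d)^n × (ZMod d)^n`, vectors written `(q, p)`. -/
abbrev V (d n : ℕ) := (Fin n → ZMod d) × (Fin n → ZMod d)

/-- Dot product of two vectors in `(ZMod d)^n`. -/
def dotp {d n : ℕ} (p q : Fin n → ZMod d) : ZMod d := ∑ i, p i * q i

/-- The standard symplectic form `omega((q1,p1),(q2,p2)) = p1·q2 - p2·q1`. -/
def omegaF {d n : ℕ} (v w : V d n) : ZMod d := dotp v.2 w.1 - dotp w.2 v.1

/-- Componentwise reduction mod `d`, `V' → V`. -/
def reduceV (d n : ℕ) (v : V (dp d) n) : V d n :=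
  (fun i => ZMod.castHom (d_dvd_dp d) (ZMod d) (v.1 i),
   fun i => ZMod.castHom (d_dvd_dp d) (ZMod d) (v.2 i))

/-- Componentwise `val`-lift `V → V'`. -/
def liftV (d n : ℕ) (u : V d n) : V (dp d) n :=
  (fun i => ((u.1 i).val : ZMod (dp d)), fun i => ((u.2 i).val : ZMod (dp d)))

/-- `zeta = exp(2 pi i / d)`. -/
def zeta (d : ℕ) : ℂ := Complex.exp (2 * Real.pi * Complex.I / d)

/-- `tau = exp(pi i / d)` if `d` is even, `tau = zeta^((d+1)/2)` if `d` is odd. -/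
def tau (d : ℕ) : ℂ :=
  if Even d then Complex.exp (Real.pi * Complex.I / d) else zeta d ^ ((d + 1) / 2)

/-- The Pauli matrix `D_(q,p) = X^q Z^p`, a `d^n × d^n` complex matrix. -/
def Dop (d n : ℕ) [NeZero d] (u : V d n) : Matrix (Fin n → ZMod d) (Fin n → ZMod d) ℂ :=
  fun r s => if r = s + u.1 then zeta d ^ (dotp u.2 s).val else 0

/-- The displacement operator `Delta_v = tau^(q·p) D_(vbar)` for `v = (q,p) ∈ V'`. -/
def Delta (d n : ℕ) [NeZero d] (v : V (dp d) n) : Matrix (Fin n → ZMod d) (Fin n → ZMod d) ℂ :=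
  tau d ^ (dotp v.1 v.2).val • Dop d n (reduceV d n v)

/-- The large Pauli group `P'`: the subgroup of invertible `d^n × d^n` complex matrices
generated by the scalar matrix `tau • 1` together with all `D_u`, `u ∈ V`. -/
def Pgrp (d n : ℕ) [NeZero d] : Subgroup (Matrix (Fin n → ZMod d) (Fin n → ZMod d) ℂ)ˣ :=
  Subgroup.closure {x | (x : Matrix (Fin n → ZMod d) (Fin n → ZMod d) ℂ)
      = tau d • (1 : Matrix (Fin n → ZMod d) (Fin n → ZMod d) ℂ)
    ∨ ∃ u : V d n, (x : Matrix (Fin n → ZMod d) (Fin n → ZMod d) ℂ) = Dop d n u}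

/-- The underlying matrix of an element of `P'`. -/
def matVal {d n : ℕ} [NeZero d] (g : ↥(Pgrp d n)) : Matrix (Fin n → ZMod d) (Fin n → ZMod d) ℂ :=
  ((g : (Matrix (Fin n → ZMod d) (Fin n → ZMod d) ℂ)ˣ) : Matrix (Fin n → ZMod d) (Fin n → ZMod d) ℂ)

/-- A function `γ : P' → P'` is center-respecting if `γ(z*g) = z*γ(g)`
for every `z` in the center of `P'`. -/
def CenterResp {d n : ℕ} [NeZero d] (γ : ↥(Pgrp d n) → ↥(Pgrp d n)) : Prop :=
  ∀ z ∈ Subgroup.center ↥(Pgrp d n), ∀ g, γ (z * g) = z * γ g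

/-- A group automorphism of `P'` is projective Clifford if it fixes the center pointwise. -/
def IsPCl {d n : ℕ} [NeZero d] (γ : ↥(Pgrp d n) ≃* ↥(Pgrp d n)) : Prop :=
  ∀ z ∈ Subgroup.center ↥(Pgrp d n), γ z = z

/-- A linear automorphism is symplectic if it preserves the standard symplectic form. -/
def IsSymp (d n : ℕ) (ψ : V d n ≃ₗ[ZMod d] V d n) : Prop :=
  ∀ u v : V d n, omegaF (ψ u) (ψ v) = omegaF u v

/-- `b` is a standard basis vector of `V`. -/
def IsStdBasis {d n : ℕ} (b : V d n) : Prop :=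
  (∃ i : Fin n, b = (Pi.single i 1, 0)) ∨ (∃ i : Fin n, b = (0, Pi.single i 1))

lemma zeta_pow_self (d : ℕ) [NeZero d] : zeta d ^ d = 1 := by
  have hd : (d : ℂ) ≠ 0 := Nat.cast_ne_zero.2 (NeZero.ne d)
  rw [zeta, ← Complex.exp_nat_mul, mul_div_cancel₀ _ hd, Complex.exp_two_pi_mul_I]

lemma tau_sq (d : ℕ) [NeZero d] : tau d ^ 2 = zeta d := by
  unfold tau
  split_ifs with h
  · rw [zeta, ← Complex.exp_nat_mul]
    congr 1
    push_cast
    ring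
  · have hdk : (d + 1) / 2 * 2 = d + 1 :=
      Nat.div_mul_cancel (Nat.not_even_iff_odd.1 h).add_one.two_dvd
    rw [← pow_mul, hdk, pow_succ, zeta_pow_self, one_mul]

lemma tau_pow_dp (d : ℕ) [NeZero d] : tau d ^ dp d = 1 := by
  unfold dp
  split_ifs with h
  · rw [pow_mul, tau_sq, zeta_pow_self]
  · rw [tau, if_neg h, ← pow_mul, mul_comm, pow_mul, zeta_pow_self, one_pow]

instance (d : ℕ) [NeZero d] : NeZero (dp d) := by
  constructor
  have := NeZero.ne d
  unfold dp
  split_ifs <;> omega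

lemma pow_val_natCast {m : ℕ} {z : ℂ} (hz : z ^ m = 1) (k : ℕ) :
    z ^ (k : ZMod m).val = z ^ k := by
  rw [ZMod.val_natCast, ← pow_eq_pow_mod k hz]

lemma pow_val_add {m : ℕ} [NeZero m] {z : ℂ} (hz : z ^ m = 1) (a b : ZMod m) :
    z ^ (a + b).val = z ^ a.val * z ^ b.val := by
  rw [ZMod.val_add, ← pow_eq_pow_mod _ hz, pow_add]

lemma tau_pow_add (d : ℕ) [NeZero d] (a b : ZMod (dp d)) :
    tau d ^ (a + b).val = tau d ^ a.val * tau d ^ b.val :=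
  pow_val_add (tau_pow_dp d) a b

lemma zeta_pow_castHom (d : ℕ) [NeZero d] (a : ZMod (dp d)) :
    zeta d ^ (ZMod.castHom (d_dvd_dp d) (ZMod d) a).val = tau d ^ (a + a).val := by
  obtain ⟨k, rfl⟩ := ZMod.natCast_zmod_surjective a
  rw [map_natCast, pow_val_natCast (zeta_pow_self d), ← Nat.cast_add,
    pow_val_natCast (tau_pow_dp d), ← tau_sq, ← pow_mul, two_mul]

lemma dotp_add_right {d n : ℕ} (p q r : Fin n → ZMod d) :
    dotp p (q + r) = dotp p q + dotp p r := by
  simp [dotp, mul_add, Finset.sum_add_distrib]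

lemma dotp_add_left {d n : ℕ} (p q r : Fin n → ZMod d) :
    dotp (p + q) r = dotp p r + dotp q r := by
  simp [dotp, add_mul, Finset.sum_add_distrib]

lemma dotp_comm {d n : ℕ} (p q : Fin n → ZMod d) : dotp p q = dotp q p := by
  simp [dotp, mul_comm]

lemma omegaF_neg_self {d n : ℕ} (v : V d n) : omegaF v (-v) = 0 := by
  simp [omegaF, dotp]

lemma reduceV_add {d n : ℕ} (v w : V (dp d) n) :
    reduceV d n (v + w) = reduceV d n v + reduceV d n w := by
  ext i <;> simp only [reduceV, Prod.fst_add, Prod.snd_add, Pi.add_apply, map_add]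

lemma reduceV_liftV {d n : ℕ} [NeZero d] (u : V d n) : reduceV d n (liftV d n u) = u := by
  ext i <;> simp only [reduceV, liftV, map_natCast, ZMod.natCast_zmod_val]

lemma dotp_reduceV {d n : ℕ} (v w : V (dp d) n) :
    dotp (reduceV d n v).2 (reduceV d n w).1 =
      ZMod.castHom (d_dvd_dp d) (ZMod d) (dotp v.2 w.1) := by
  simp only [dotp, reduceV, map_sum, map_mul]

lemma Dop_mul (d n : ℕ) [NeZero d] (u w : V d n) :
    Dop d n u * Dop d n w = zeta d ^ (dotp u.2 w.1).val • Dop d n (u + w) := by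
  ext r s
  simp only [Matrix.mul_apply, Matrix.smul_apply, Dop, smul_eq_mul, mul_ite, mul_zero,
    Finset.sum_ite_eq', Finset.mem_univ, if_true, Prod.fst_add, Prod.snd_add,
    dotp_add_left, dotp_add_right, pow_val_add (zeta_pow_self d)]
  have : s + w.1 + u.1 = s + (u.1 + w.1) := by abel
  rw [this, ite_mul, zero_mul]
  congr 1
  ring

/-- The multiplication rule of the displacement operators. -/
lemma Delta_mul (d n : ℕ) [NeZero d] (v w : V (dp d) n) :
    Delta d n v * Delta d n w = tau d ^ (omegaF v w).val • Delta d n (v + w) := by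
  simp only [Delta, Matrix.smul_mul, Matrix.mul_smul, smul_smul, Dop_mul, dotp_reduceV,
    zeta_pow_castHom, ← tau_pow_add, reduceV_add]
  congr 3
  simp only [omegaF, Prod.fst_add, Prod.snd_add, dotp_add_left, dotp_add_right]
  rw [dotp_comm v.1 w.2, dotp_comm w.1 v.2]
  ring

lemma Delta_zero (d n : ℕ) [NeZero d] : Delta d n 0 = 1 := by
  have h0 : reduceV d n 0 = 0 := by ext i <;> simp [reduceV]
  ext r s
  simp [Delta, Dop, dotp, h0, Matrix.one_apply]

/-- The operator `tau^c Delta_v`. -/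
def phaseDelta (d n : ℕ) [NeZero d] (c : ZMod (dp d)) (v : V (dp d) n) :
    Matrix (Fin n → ZMod d) (Fin n → ZMod d) ℂ :=
  tau d ^ c.val • Delta d n v

lemma phaseDelta_mul (d n : ℕ) [NeZero d] (a b : ZMod (dp d)) (v w : V (dp d) n) :
    phaseDelta d n a v * phaseDelta d n b w = phaseDelta d n (a + b + omegaF v w) (v + w) := by
  simp only [phaseDelta, Matrix.smul_mul, Matrix.mul_smul, smul_smul, Delta_mul, ← tau_pow_add]
  congr 3
  ring

lemma phaseDelta_zero (d n : ℕ) [NeZero d] : phaseDelta d n 0 0 = 1 := by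
  simp [phaseDelta, Delta_zero]

lemma phaseDelta_mul_neg (d n : ℕ) [NeZero d] (c : ZMod (dp d)) (v : V (dp d) n) :
    phaseDelta d n c v * phaseDelta d n (-c) (-v) = 1 := by
  rw [phaseDelta_mul, omegaF_neg_self, add_neg_cancel, add_neg_cancel, add_zero, phaseDelta_zero]

/-- `tau^c Delta_v` as an invertible matrix. -/
def phaseDeltaUnit (d n : ℕ) [NeZero d] (c : ZMod (dp d)) (v : V (dp d) n) :
    (Matrix (Fin n → ZMod d) (Fin n → ZMod d) ℂ)ˣ where
  val := phaseDelta d n c v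
  inv := phaseDelta d n (-c) (-v)
  val_inv := phaseDelta_mul_neg d n c v
  inv_val := by simpa using phaseDelta_mul_neg d n (-c) (-v)

lemma Dop_eq_phaseDelta (d n : ℕ) [NeZero d] (v : V (dp d) n) :
    Dop d n (reduceV d n v) = phaseDelta d n (-dotp v.1 v.2) v := by
  rw [phaseDelta, Delta, smul_smul, ← tau_pow_add, neg_add_cancel, ZMod.val_zero, pow_zero,
    one_smul]

lemma tau_smul_one_eq_phaseDelta (d n : ℕ) [NeZero d] :
    tau d • (1 : Matrix (Fin n → ZMod d) (Fin n → ZMod d) ℂ) = phaseDelta d n 1 0 := by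
  have h := pow_val_natCast (tau_pow_dp d) 1
  rw [Nat.cast_one, pow_one] at h
  rw [phaseDelta, Delta_zero, h]

lemma phaseDeltaUnit_mem (d n : ℕ) [NeZero d] (c : ZMod (dp d)) (v : V (dp d) n) :
    phaseDeltaUnit d n c v ∈ Pgrp d n := by
  have hτ : phaseDeltaUnit d n 1 0 ∈ Pgrp d n :=
    Subgroup.subset_closure (Or.inl (tau_smul_one_eq_phaseDelta d n).symm)
  have hD : phaseDeltaUnit d n (-dotp v.1 v.2) v ∈ Pgrp d n :=
    Subgroup.subset_closure (Or.inr ⟨reduceV d n v, (Dop_eq_phaseDelta d n v).symm⟩)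
  have heq : phaseDeltaUnit d n c v = phaseDeltaUnit d n 1 0 ^ (c + dotp v.1 v.2).val *
      phaseDeltaUnit d n (-dotp v.1 v.2) v := by
    ext1
    rw [Units.val_mul, Units.val_pow_eq_pow_val]
    change phaseDelta d n c v = phaseDelta d n 1 0 ^ _ * phaseDelta d n _ v
    rw [← tau_smul_one_eq_phaseDelta, smul_pow, one_pow, Matrix.smul_mul, one_mul,
      phaseDelta, phaseDelta, smul_smul, ← tau_pow_add, add_neg_cancel_right]
  rw [heq]
  exact mul_mem (pow_mem hτ _) hD

lemma exists_eq_phaseDelta {d n : ℕ} [NeZero d] (g : ↥(Pgrp d n)) :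
    ∃ c v, matVal g = phaseDelta d n c v := by
  obtain ⟨x, hx⟩ := g
  suffices h : ∃ c v, x = phaseDeltaUnit d n c v by
    obtain ⟨c, v, rfl⟩ := h
    exact ⟨c, v, rfl⟩
  refine Subgroup.closure_induction ?_ ?_ ?_ ?_ hx
  · rintro x (h | ⟨u, h⟩)
    · exact ⟨1, 0, Units.ext (h.trans (tau_smul_one_eq_phaseDelta d n))⟩
    · rw [← reduceV_liftV u] at h
      exact ⟨_, _, Units.ext (h.trans (Dop_eq_phaseDelta d n _))⟩
  · exact ⟨0, 0, Units.ext (phaseDelta_zero d n).symm⟩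
  · rintro _ _ _ _ ⟨a, v, rfl⟩ ⟨b, w, rfl⟩
    exact ⟨_, _, Units.ext (phaseDelta_mul d n a b v w)⟩
  · rintro _ _ ⟨a, v, rfl⟩
    exact ⟨-a, -v, Units.ext rfl⟩

/-- `tau^c Delta_v` as an element of the large Pauli group. -/
def phaseDeltaP (d n : ℕ) [NeZero d] (c : ZMod (dp d)) (v : V (dp d) n) : ↥(Pgrp d n) :=
  ⟨phaseDeltaUnit d n c v, phaseDeltaUnit_mem d n c v⟩

lemma matVal_injective {d n : ℕ} [NeZero d] :
    Function.Injective (matVal : ↥(Pgrp d n) → _) :=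
  fun _ _ h => Subtype.ext (Units.ext h)

lemma exists_eq_phaseDeltaP {d n : ℕ} [NeZero d] (g : ↥(Pgrp d n)) :
    ∃ c v, g = phaseDeltaP d n c v := by
  obtain ⟨c, v, h⟩ := exists_eq_phaseDelta g
  exact ⟨c, v, matVal_injective h⟩

lemma phaseDeltaP_mul (d n : ℕ) [NeZero d] (a b : ZMod (dp d)) (v w : V (dp d) n) :
    phaseDeltaP d n a v * phaseDeltaP d n b w =
      phaseDeltaP d n (a + b + omegaF v w) (v + w) :=
  matVal_injective (phaseDelta_mul d n a b v w)

lemma omegaF_zero_left {d n : ℕ} (v : V d n) : omegaF 0 v = 0 := by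
  simp [omegaF, dotp]

lemma omegaF_zero_right {d n : ℕ} (v : V d n) : omegaF v 0 = 0 := by
  simp [omegaF, dotp]

lemma phaseDeltaP_zero_mem_center (d n : ℕ) [NeZero d] (c : ZMod (dp d)) :
    phaseDeltaP d n c 0 ∈ Subgroup.center ↥(Pgrp d n) := by
  rw [Subgroup.mem_center_iff]
  intro g
  obtain ⟨a, v, rfl⟩ := exists_eq_phaseDeltaP g
  rw [phaseDeltaP_mul, phaseDeltaP_mul, omegaF_zero_left, omegaF_zero_right, add_comm a c,
    add_comm v 0]

instance (d n : ℕ) [NeZero d] : Finite ↥(Pgrp d n) :=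
  Finite.of_surjective (fun x : ZMod (dp d) × V (dp d) n => phaseDeltaP d n x.1 x.2) fun g => by
    obtain ⟨c, v, h⟩ := exists_eq_phaseDeltaP g
    exact ⟨(c, v), h.symm⟩

theorem centerResp_symplectic_is_PCl (d n : ℕ) [NeZero d] (hd : 2 ≤ d) (hn : 1 ≤ n)
    (γ : ↥(Pgrp d n) → ↥(Pgrp d n)) (hγ : CenterResp γ)
    (lam : V (dp d) n →+ ZMod (dp d)) (φ : V (dp d) n ≃ₗ[ZMod (dp d)] V (dp d) n)
    (hφ : IsSymp (dp d) n φ)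
    (h : ∀ v : V (dp d) n, ∀ g : ↥(Pgrp d n), matVal g = Delta d n v →
        matVal (γ g) = tau d ^ (lam v).val • Delta d n (φ v)) :
    ∃ γ' : ↥(Pgrp d n) ≃* ↥(Pgrp d n), IsPCl γ' ∧ ∀ g, γ' g = γ g := by
  have hγP : ∀ c v, γ (phaseDeltaP d n c v) = phaseDeltaP d n (c + lam v) (φ v) := by
    intro c v
    have hv : matVal (phaseDeltaP d n 0 v) = Delta d n v := by
      change tau d ^ (0 : ZMod (dp d)).val • Delta d n v = _
      rw [ZMod.val_zero, pow_zero, one_smul]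
    have hγv : γ (phaseDeltaP d n 0 v) = phaseDeltaP d n (lam v) (φ v) :=
      matVal_injective (h v _ hv)
    have hsplit : phaseDeltaP d n c v = phaseDeltaP d n c 0 * phaseDeltaP d n 0 v := by
      rw [phaseDeltaP_mul, omegaF_zero_left, add_zero, add_zero, zero_add]
    rw [hsplit, hγ _ (phaseDeltaP_zero_mem_center d n c), hγv, phaseDeltaP_mul,
      omegaF_zero_left, add_zero, zero_add]
  have hmul : ∀ x y, γ (x * y) = γ x * γ y := by
    intro x y
    obtain ⟨a, v, rfl⟩ := exists_eq_phaseDeltaP x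
    obtain ⟨b, w, rfl⟩ := exists_eq_phaseDeltaP y
    rw [phaseDeltaP_mul, hγP, hγP, hγP, phaseDeltaP_mul, hφ v w, map_add, map_add]
    congr 1
    ring
  have hsurj : Function.Surjective γ := by
    intro y
    obtain ⟨c, w, rfl⟩ := exists_eq_phaseDeltaP y
    refine ⟨phaseDeltaP d n (c - lam (φ.symm w)) (φ.symm w), ?_⟩
    rw [hγP, sub_add_cancel, LinearEquiv.apply_symm_apply]
  let f : ↥(Pgrp d n) →* ↥(Pgrp d n) := MonoidHom.mk' γ hmul
  refine ⟨MulEquiv.ofBijective f ⟨Finite.injective_iff_surjective.2 hsurj, hsurj⟩, ?_,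
    fun _ => rfl⟩
  intro z hz
  change γ z = z
  have h1 : γ 1 = 1 := map_one f
  simpa [h1] using hγ z hz 1

end PaperPCl
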